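/- arXiv:math/9805066 — 9 statements merged into one kernel-verified Lean document; each statement's English description precedes it below -/
import Mathlib

section
/- Let G be a finite simple graph on n vertices, and let s and t be integers with s > t > 0. If G is s-choosable, then λ_t(G) ≥ q_{s,t} · n. -/
/-- `G` is `s`-choosable: every assignment of lists of `s` colors to the vertices
admits a proper coloring in which each vertex gets a color from its own list. -/
def Choosable {V : Type*} (G : SimpleGraph V) (s : ℕ) : Prop :=
  ∀ ℓ : V → Finset ℕ, (∀ v, (ℓ v).card = s) →
    ∃ c : V → ℕ, (∀ v, c v ∈ ℓ v) ∧ ∀ u w, G.Adj u w → c u ≠ c w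

/-- The maximum number of vertices of `G` colorable in a partial coloring from
the lists `ℓ` (a proper coloring of a subset of the vertices, each colored vertex
receiving a color from its own list). -/
noncomputable def maxColorable {V : Type*} (G : SimpleGraph V) (ℓ : V → Finset ℕ) : ℕ :=
  sSup { m | ∃ S : Finset V,
    (∃ c : V → ℕ, (∀ v ∈ S, c v ∈ ℓ v) ∧
      ∀ u ∈ S, ∀ w ∈ S, G.Adj u w → c u ≠ c w) ∧ S.card = m }

/-- `λ_t(G)`: the minimum over list assignments `ℓ` of size `t` of the maximum
number of vertices colorable in a partial coloring from `ℓ`. -/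
noncomputable def lambdaList {V : Type*} (G : SimpleGraph V) (t : ℕ) : ℕ :=
  sInf { m | ∃ ℓ : V → Finset ℕ, (∀ v, (ℓ v).card = t) ∧ maxColorable G ℓ = m }

/-- The list-chromatic number of `G`: the least `s` such that `G` is `s`-choosable. -/
noncomputable def listChromNum {V : Type*} (G : SimpleGraph V) : ℕ :=
  sInf { s | Choosable G s }

/-- The function `f_{s,t}(x) = 1 - x - (1 - (1 - x)/(s - t))^t`. -/
noncomputable def fst (s t : ℕ) (x : ℝ) : ℝ :=
  1 - x - (1 - (1 - x) / ((s : ℝ) - (t : ℝ))) ^ t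


/-- The key probabilistic statement, as a weighted average over all functions
assigning to every old color either itself or one of the `k` fresh colors. -/
theorem exists_good_partial {V : Type*} [Fintype V] (G : SimpleGraph V) (k t N : ℕ)
    (hk : 0 < k) (q : ℝ) (hq : 0 < q) (hq1 : q < 1)
    (hroot : (1 - (1 - q) / (k : ℝ)) ^ t = 1 - q)
    (l : V → Finset ℕ) (hl : ∀ v, (l v).card = t) (hN : ∀ v, ∀ a ∈ l v, a < N)
    (c : V → ℕ) (hc : ∀ v, c v ∈ l v ∨ ∃ i : Fin k, c v = N + i)
    (hcp : ∀ u w, G.Adj u w → c u ≠ c w) :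
    ∃ S : Finset V, (∃ d : V → ℕ, (∀ v ∈ S, d v ∈ l v) ∧
      ∀ u ∈ S, ∀ w ∈ S, G.Adj u w → d u ≠ d w) ∧ q * (Fintype.card V : ℝ) ≤ (S.card : ℝ) := by
  classical
  have hkR : (0 : ℝ) < k := by exact_mod_cast hk
  have hk1 : (1 : ℝ) ≤ k := by exact_mod_cast hk
  let wt : Option (Fin k) → ℝ := fun o => match o with
    | none => q
    | some _ => (1 - q) / k
  let g : Fin N → Option (Fin k) → ℕ := fun a o => match o with
    | none => a
    | some i => N + i
  have wt0 : ∀ o, 0 ≤ wt o := by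
    intro o
    cases o with
    | none => exact hq.le
    | some i => exact div_nonneg (by linarith) hkR.le
  have wtsum : ∑ o, wt o = 1 := by
    rw [Fintype.sum_option]
    simp only [wt, Finset.sum_const, Finset.card_univ, Fintype.card_fin, nsmul_eq_mul]
    field_simp
    ring
  let W : (Fin N → Option (Fin k)) → ℝ := fun φ => ∏ a, wt (φ a)
  have W0 : ∀ φ, 0 ≤ W φ := fun φ => Finset.prod_nonneg fun a _ => wt0 _
  have Wsum : ∑ φ, W φ = 1 := by
    have := Fintype.prod_sum (fun (_ : Fin N) (o : Option (Fin k)) => wt o)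
    simp only [wtsum, Finset.prod_const_one] at this
    exact this.symm
  let bad : V → Fin N → Option (Fin k) → Prop := fun v a o => (a : ℕ) ∈ l v ∧ c v = g a o
  let S : (Fin N → Option (Fin k)) → Finset V := fun φ =>
    Finset.univ.filter fun v => ∃ a, bad v a (φ a)
  have key : ∀ v, ∑ φ, W φ * (if ∃ a, bad v a (φ a) then 0 else 1) ≤ 1 - q := by
    intro v
    have h1 : ∀ φ : Fin N → Option (Fin k), W φ * (if ∃ a, bad v a (φ a) then 0 else 1)
        = ∏ a, (wt (φ a) * if bad v a (φ a) then 0 else 1) := by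
      intro φ
      rw [Finset.prod_mul_distrib]
      congr 1
      split_ifs with h
      · obtain ⟨a, ha⟩ := h
        exact (Finset.prod_eq_zero (Finset.mem_univ a) (by rw [if_pos ha])).symm
      · push Not at h
        exact (Finset.prod_eq_one fun a _ => by rw [if_neg (h a)]).symm
    rw [Finset.sum_congr rfl fun φ _ => h1 φ,
      ← Fintype.prod_sum (fun a o => wt o * if bad v a o then (0:ℝ) else 1)]
    have hF0 : ∀ a, 0 ≤ ∑ o, wt o * (if bad v a o then (0:ℝ) else 1) := fun a =>
      Finset.sum_nonneg fun o _ => mul_nonneg (wt0 o) (by split_ifs <;> norm_num)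
    have hF1 : ∀ a, ∑ o, wt o * (if bad v a o then (0:ℝ) else 1) ≤ 1 := fun a => by
      refine le_of_le_of_eq (Finset.sum_le_sum fun o _ => ?_) wtsum
      have := wt0 o
      split_ifs <;> simp [this]
    have hFo : ∀ a o, bad v a o → ∑ o, wt o * (if bad v a o then (0:ℝ) else 1) ≤ 1 - wt o := by
      intro a o ho
      have e : ∑ x, (if x = o then 0 else wt x) = 1 - wt o := by
        rw [← wtsum, ← Finset.sum_erase_add _ _ (Finset.mem_univ o),
          ← Finset.sum_erase_add _ wt (Finset.mem_univ o)]
        simp only [if_true]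
        have : ∑ x ∈ Finset.univ.erase o, (if x = o then 0 else wt x)
            = ∑ x ∈ Finset.univ.erase o, wt x :=
          Finset.sum_congr rfl fun x hx => if_neg (Finset.ne_of_mem_erase hx)
        rw [this]; ring
      rw [← e]
      refine Finset.sum_le_sum fun x _ => ?_
      by_cases hx : x = o
      · subst hx; simp [ho]
      · rw [if_neg hx]
        have := wt0 x
        split_ifs <;> simp [this]
    rcases hc v with hv | ⟨i, hi⟩
    · have hb : bad v ⟨c v, hN v _ hv⟩ none := ⟨hv, rfl⟩
      rw [← Finset.mul_prod_erase _ _ (Finset.mem_univ (⟨c v, hN v _ hv⟩ : Fin N))]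
      calc _ ≤ (1 - q) * 1 := by
            refine mul_le_mul (hFo _ none hb) ?_ (Finset.prod_nonneg fun a _ => hF0 a) (by linarith)
            exact Finset.prod_le_one (fun a _ => hF0 a) (fun a _ => hF1 a)
        _ = 1 - q := mul_one _
    · calc _ ≤ ∏ a : Fin N, (if (a : ℕ) ∈ l v then (1 - (1 - q) / (k : ℝ)) else 1) := by
            refine Finset.prod_le_prod (fun a _ => hF0 a) fun a _ => ?_
            split_ifs with ha
            · exact hFo a (some i) ⟨ha, hi⟩
            · exact hF1 a
        _ = (1 - (1 - q) / (k : ℝ)) ^ t := by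
            rw [← Finset.prod_range (fun a => if a ∈ l v then (1 - (1 - q) / (k : ℝ)) else 1),
              Finset.prod_ite, Finset.prod_const, Finset.prod_const_one, mul_one, ← hl v]
            congr 2
            ext a
            simp only [Finset.mem_filter, Finset.mem_range]
            exact ⟨fun h => h.2, fun h => ⟨hN v a h, h⟩⟩
        _ = 1 - q := hroot
        _ ≤ _ := le_rfl
  have key2 : q * (Fintype.card V : ℝ) ≤ ∑ φ, W φ * ((S φ).card : ℝ) := by
    have e : ∀ φ, ((S φ).card : ℝ) = ∑ v, (1 - if ∃ a, bad v a (φ a) then (0:ℝ) else 1) := by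
      intro φ
      rw [Finset.card_filter]
      push_cast
      refine Finset.sum_congr rfl fun v _ => ?_
      split_ifs <;> norm_num
    simp only [e, Finset.mul_sum]
    rw [Finset.sum_comm]
    calc q * (Fintype.card V : ℝ) = ∑ v : V, q := by simp [mul_comm]
      _ ≤ _ := by
        refine Finset.sum_le_sum fun v _ => ?_
        simp only [mul_sub, mul_one, Finset.sum_sub_distrib, Wsum]
        linarith [key v]
  have : ∃ φ, q * (Fintype.card V : ℝ) ≤ ((S φ).card : ℝ) := by
    by_contra! hcon
    have hlt : ∑ φ, W φ * ((S φ).card : ℝ) < ∑ φ, W φ * (q * (Fintype.card V : ℝ)) := by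
      obtain ⟨φ, -, hφ⟩ := Finset.exists_ne_zero_of_sum_ne_zero (by rw [Wsum]; norm_num)
      refine Finset.sum_lt_sum (fun ψ _ => mul_le_mul_of_nonneg_left (hcon ψ).le (W0 ψ))
        ⟨φ, Finset.mem_univ _, mul_lt_mul_of_pos_left (hcon φ) (lt_of_le_of_ne (W0 φ) hφ.symm)⟩
    rw [← Finset.sum_mul, Wsum, one_mul] at hlt
    linarith
  obtain ⟨φ, hφ⟩ := this
  refine ⟨S φ, ?_, hφ⟩
  have hS : ∀ v, ∃ d : ℕ, v ∈ S φ → ∃ a : Fin N, d = a ∧ bad v a (φ a) := by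
    intro v
    by_cases h : v ∈ S φ
    · obtain ⟨a, ha⟩ := (Finset.mem_filter.1 h).2
      exact ⟨a, fun _ => ⟨a, rfl, ha⟩⟩
    · exact ⟨0, fun h' => absurd h' h⟩
  choose d hd using hS
  refine ⟨d, fun v hv => ?_, fun u hu w hw hadj heq => ?_⟩
  · obtain ⟨a, e, ha⟩ := hd v hv
    rw [e]; exact ha.1
  · obtain ⟨a, e, ha⟩ := hd u hu
    obtain ⟨b, e', hb⟩ := hd w hw
    have : a = b := Fin.ext (by rw [← e, ← e', heq])
    subst this
    exact hcp u w hadj (ha.2.trans hb.2.symm)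

theorem stmt0 {V : Type*} [Fintype V] (G : SimpleGraph V) (s t : ℕ)
    (hts : t < s) (ht : 0 < t) (hch : Choosable G s)
    (q : ℝ) (hq : 0 < q) (hroot : fst s t q = 0) :
    q * (Fintype.card V : ℝ) ≤ (lambdaList G t : ℝ) := by
  classical
  obtain ⟨k, rfl⟩ := Nat.exists_eq_add_of_lt hts
  have hkk : ((t + k + 1 : ℕ) : ℝ) - (t : ℝ) = ((k + 1 : ℕ) : ℝ) := by push_cast; ring
  unfold fst at hroot
  rw [hkk] at hroot
  have hkpos : (0 : ℝ) < ((k + 1 : ℕ) : ℝ) := by positivity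
  have hq1 : q < 1 := by
    by_contra! h
    have h1 : (0:ℝ) ≤ (q - 1) / ((k + 1 : ℕ) : ℝ) := div_nonneg (by linarith) hkpos.le
    have h2 : (1 - (1 - q) / ((k + 1 : ℕ) : ℝ)) = 1 + (q - 1) / ((k + 1 : ℕ) : ℝ) := by ring
    rw [h2] at hroot
    have : 0 < (1 + (q - 1) / ((k + 1 : ℕ) : ℝ)) ^ t := pow_pos (by linarith) t
    linarith
  have hmem : lambdaList G t ∈ { m | ∃ ℓ : V → Finset ℕ, (∀ v, (ℓ v).card = t) ∧
      maxColorable G ℓ = m } :=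
    Nat.sInf_mem ⟨_, fun _ => Finset.range t, fun _ => Finset.card_range t, rfl⟩
  obtain ⟨l, hl, hm⟩ := hmem
  rw [← hm]
  obtain ⟨N, hN⟩ : ∃ N, ∀ v, ∀ a ∈ l v, a < N := by
    refine ⟨(Finset.univ.biUnion l).sup id + 1, fun v a ha => Nat.lt_succ_of_le ?_⟩
    exact Finset.le_sup (f := id) (Finset.mem_biUnion.2 ⟨v, Finset.mem_univ v, ha⟩)
  obtain ⟨c, hc, hcp⟩ := hch (fun v => l v ∪ (Finset.range (k + 1)).image (N + ·)) (by
    intro v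
    rw [Finset.card_union_of_disjoint, hl, Finset.card_image_of_injective _
      (add_right_injective N), Finset.card_range, add_assoc]
    rw [Finset.disjoint_left]
    intro a ha hb
    obtain ⟨i, -, rfl⟩ := Finset.mem_image.1 hb
    have := hN v _ ha
    omega)
  obtain ⟨S, hS, hcard⟩ := exists_good_partial G (k + 1) t N (Nat.succ_pos k) q hq hq1
    (by linarith) l hl hN c (by
      intro v
      rcases Finset.mem_union.1 (hc v) with h | h
      · exact Or.inl h
      · obtain ⟨i, hi, e⟩ := Finset.mem_image.1 h
        exact Or.inr ⟨⟨i, Finset.mem_range.1 hi⟩, e.symm⟩) hcp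
  refine hcard.trans ?_
  have : S.card ≤ maxColorable G l := by
    refine le_csSup ⟨Fintype.card V, ?_⟩ ⟨S, hS, rfl⟩
    rintro m ⟨T, -, rfl⟩
    exact Finset.card_le_univ T
  exact_mod_cast this
end

section
/- Let G be a finite simple graph on n ≥ 1 vertices, and let s and t be integers with s > t > 1. If G is s-choosable, then the inequality of the main theorem is strict: λ_t(G) > q_{s,t} · n. -/
open Classical in
theorem weight_sum {M : ℕ} {X : Type} [Fintype X] (p h : X → ℝ) (hp : ∑ x, p x = 1)
    (T : Finset (Fin M)) :
    ∑ φ : Fin M → X, (∏ a, p (φ a)) * (∏ a ∈ T, h (φ a)) = (∑ x, p x * h x) ^ T.card := by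
  have h1 : ∀ φ : Fin M → X, (∏ a, p (φ a)) * (∏ a ∈ T, h (φ a))
      = ∏ a, p (φ a) * (if a ∈ T then h (φ a) else 1) := by
    intro φ
    rw [Finset.prod_mul_distrib]
    congr 1
    rw [Finset.prod_ite_mem, Finset.univ_inter]
  simp_rw [h1]
  rw [← Fintype.piFinset_univ,
    ← Finset.prod_univ_sum (fun _ => Finset.univ)
      (fun (a : Fin M) (x : X) => p x * (if a ∈ T then h x else 1))]
  have h2 : ∀ a : Fin M, ∑ x, p x * (if a ∈ T then h x else 1)
      = if a ∈ T then ∑ x, p x * h x else 1 := by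
    intro a
    by_cases ha : a ∈ T <;> simp [ha, hp]
  simp_rw [h2]
  rw [Finset.prod_ite_mem, Finset.univ_inter, Finset.prod_const]

theorem le_maxColorable {V : Type*} [Fintype V] (G : SimpleGraph V) (ℓ : V → Finset ℕ)
    (S : Finset V) (c : V → ℕ) (h1 : ∀ v ∈ S, c v ∈ ℓ v)
    (h2 : ∀ u ∈ S, ∀ w ∈ S, G.Adj u w → c u ≠ c w) : S.card ≤ maxColorable G ℓ := by
  apply le_csSup
  · refine ⟨Fintype.card V, ?_⟩
    rintro m ⟨S, -, rfl⟩
    exact Finset.card_le_univ S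
  · exact ⟨S, ⟨c, h1, h2⟩, rfl⟩

/-- `v` can receive color `a` under the color allocation `φ`. -/
def Good {V : Type*} (ℓ : V → Finset ℕ) (c : V → ℕ) {M k : ℕ} (φ : Fin M → Option (Fin k))
    (v : V) (a : Fin M) : Prop :=
  (a : ℕ) ∈ ℓ v ∧ ((φ a = none ∧ c v = a) ∨ ∃ j : Fin k, φ a = some j ∧ c v = M + j)

open Classical in
theorem good_card_le {V : Type*} [Fintype V] (G : SimpleGraph V) (ℓ : V → Finset ℕ) (c : V → ℕ)
    (hc : ∀ u w, G.Adj u w → c u ≠ c w) {M k : ℕ} (φ : Fin M → Option (Fin k)) :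
    (Finset.univ.filter (fun v => ∃ a, Good ℓ c φ v a)).card ≤ maxColorable G ℓ := by
  refine le_maxColorable G ℓ _
    (fun v => if h : ∃ a, Good ℓ c φ v a then (h.choose : ℕ) else 0) ?_ ?_
  · intro v hv
    have h : ∃ a, Good ℓ c φ v a := by simpa using hv
    simp only [h, dif_pos]
    exact h.choose_spec.1
  · intro u hu w hw huw
    have h : ∃ a, Good ℓ c φ u a := by simpa using hu
    have h' : ∃ a, Good ℓ c φ w a := by simpa using hw
    simp only [h, h', dif_pos]
    intro he
    have he' : h.choose = h'.choose := Fin.ext he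
    have a1 := h.choose_spec.2
    have a2 := h'.choose_spec.2
    rw [← he'] at a2
    apply hc u w huw
    rcases a1 with ⟨b1, b2⟩ | ⟨j, b1, b2⟩ <;> rcases a2 with ⟨d1, d2⟩ | ⟨j', d1, d2⟩
    · rw [b2, d2]
    · simp [b1] at d1
    · simp [b1] at d1
    · rw [b1] at d1
      cases d1
      rw [b2, d2]

theorem stmt1 {V : Type*} [Fintype V] (G : SimpleGraph V) (s t : ℕ)
    (hts : t < s) (ht : 1 < t) (hn : 1 ≤ Fintype.card V) (hch : Choosable G s)
    (q : ℝ) (hq : 0 < q) (hroot : fst s t q = 0) :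
    q * (Fintype.card V : ℝ) < (lambdaList G t : ℝ) := by
  classical
  obtain ⟨ℓ, hℓ, hmax⟩ : ∃ ℓ : V → Finset ℕ, (∀ v, (ℓ v).card = t) ∧
      maxColorable G ℓ = lambdaList G t :=
    Nat.sInf_mem (s := { m | ∃ ℓ : V → Finset ℕ, (∀ v, (ℓ v).card = t) ∧ maxColorable G ℓ = m })
      ⟨_, fun _ => Finset.range t, by simp, rfl⟩
  rw [← hmax]
  by_contra hcon
  push Not at hcon
  obtain ⟨k, rfl⟩ := Nat.exists_eq_add_of_lt hts
  have hk : 0 < k + 1 := Nat.succ_pos k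
  rw [add_assoc] at *
  generalize k + 1 = k at *
  have hkR : (0 : ℝ) < k := by exact_mod_cast hk
  have hk1 : (1 : ℝ) ≤ k := by exact_mod_cast hk
  -- root facts
  obtain ⟨y, rfl⟩ : ∃ y, q = 1 - y := ⟨1 - q, by ring⟩
  have hy : y = (1 - y / k) ^ t := by
    unfold fst at hroot
    push_cast at hroot
    have e : (1 - (1 - y)) / ((t : ℝ) + k - t) = y / k := by
      congr 1 <;> ring
    rw [e] at hroot
    linarith
  have hy1 : y < 1 := by linarith
  have hbase : 0 < 1 - y / k := by
    have : y / k < 1 := by rw [div_lt_one hkR]; linarith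
    linarith
  have hy0 : 0 < y := by rw [hy]; positivity
  -- palette
  obtain ⟨M, hM⟩ : ∃ M, ∀ v, ∀ a ∈ ℓ v, a < M := by
    refine ⟨(Finset.univ.biUnion ℓ).sup id + 1, fun v a ha => ?_⟩
    have : id a ≤ (Finset.univ.biUnion ℓ).sup id :=
      Finset.le_sup (Finset.mem_biUnion.2 ⟨v, Finset.mem_univ _, ha⟩)
    exact Nat.lt_succ_of_le this
  obtain ⟨c, hcl, hc⟩ := hch (fun v => ℓ v ∪ (Finset.range k).image (fun j => M + j)) (by
    intro v
    rw [Finset.card_union_of_disjoint, hℓ, Finset.card_image_of_injective, Finset.card_range]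
    · intro a b h; simpa using h
    · rw [Finset.disjoint_left]
      intro a ha hb
      have := hM v a ha
      simp only [Finset.mem_image, Finset.mem_range] at hb
      obtain ⟨j, -, hj⟩ := hb
      omega)
  have hcase : ∀ v, (c v ∈ ℓ v ∧ c v < M) ∨ ∃ j : Fin k, c v = M + j := by
    intro v
    have := hcl v
    rw [Finset.mem_union] at this
    rcases this with h | h
    · exact Or.inl ⟨h, hM v _ h⟩
    · simp only [Finset.mem_image, Finset.mem_range] at h
      obtain ⟨j, hj, hj'⟩ := h
      exact Or.inr ⟨⟨j, hj⟩, hj'.symm⟩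
  let p : Option (Fin k) → ℝ := fun x => if x = none then 1 - y else y / k
  have hp : ∑ x, p x = 1 := by
    rw [Fintype.sum_option]
    simp [p]
    field_simp
    ring
  have hppos : ∀ x, 0 < p x := by
    intro x
    simp only [p]
    split_ifs
    · linarith
    · positivity
  let P : (Fin M → Option (Fin k)) → ℝ := fun φ => ∏ a, p (φ a)
  have hPpos : ∀ φ, 0 < P φ := fun φ => Finset.prod_pos (fun a _ => hppos _)
  have hP1 : ∑ φ, P φ = 1 := by
    have := weight_sum (M := M) p (fun _ => 1) hp ∅
    simpa using this
  let S : (Fin M → Option (Fin k)) → Finset V := fun φ =>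
    Finset.univ.filter (fun v => ∃ a, Good ℓ c φ v a)
  have hS : ∀ φ, ((S φ).card : ℝ) ≤ (1 - y) * Fintype.card V := fun φ =>
    le_trans (by exact_mod_cast good_card_le G ℓ c hc φ) hcon
  -- membership
  have hmem1 : ∀ φ v (h : c v < M), c v ∈ ℓ v → (v ∈ S φ ↔ φ ⟨c v, h⟩ = none) := by
    intro φ v h hl
    simp only [S, Finset.mem_filter, Finset.mem_univ, true_and]
    constructor
    · rintro ⟨a, -, ⟨h1, h2⟩ | ⟨j, -, h2⟩⟩
      · have : (⟨c v, h⟩ : Fin M) = a := Fin.ext h2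
        rw [this, h1]
      · omega
    · intro h1
      exact ⟨⟨c v, h⟩, hl, Or.inl ⟨h1, rfl⟩⟩
  have hmem2 : ∀ φ v (j : Fin k), c v = M + j →
      (v ∈ S φ ↔ ∃ a : Fin M, (a : ℕ) ∈ ℓ v ∧ φ a = some j) := by
    intro φ v j h
    simp only [S, Finset.mem_filter, Finset.mem_univ, true_and]
    constructor
    · rintro ⟨a, hl, ⟨h1, h2⟩ | ⟨j', h1, h2⟩⟩
      · have := a.2
        omega
      · have : j = j' := Fin.ext (by omega)
        exact ⟨a, hl, this ▸ h1⟩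
    · rintro ⟨a, hl, h1⟩
      exact ⟨a, hl, Or.inr ⟨j, h1, h⟩⟩
  have hv : ∀ v, ∑ φ, P φ * (if v ∈ S φ then (1 : ℝ) else 0) = 1 - y := by
    intro v
    rcases hcase v with ⟨hl, h⟩ | ⟨j, h⟩
    · have := weight_sum (M := M) p (fun x => if x = none then 1 else 0) hp {⟨c v, h⟩}
      rw [Finset.card_singleton, pow_one] at this
      simp only [Finset.prod_singleton] at this
      simp only [hmem1 _ v h hl]
      rw [this]
      simp [p]
    · let T : Finset (Fin M) := Finset.univ.filter (fun a => (a : ℕ) ∈ ℓ v)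
      have hT : T.card = t := by
        rw [← hℓ v]
        refine Finset.card_bij (fun a _ => (a : ℕ)) ?_ ?_ ?_
        · intro a ha; simpa [T] using ha
        · intro a _ b _ hab; exact Fin.ext hab
        · intro b hb
          exact ⟨⟨b, hM v b hb⟩, by simpa [T] using hb, rfl⟩
      have key := weight_sum (M := M) p (fun x => if x = some j then 0 else 1) hp T
      have e1 : ∑ x, p x * (if x = some j then (0 : ℝ) else 1) = 1 - y / k := by
        have : ∀ x, p x * (if x = some j then (0 : ℝ) else 1)
            = p x - (if x = some j then p x else 0) := by
          intro x; split_ifs <;> ring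
        simp_rw [this]
        rw [Finset.sum_sub_distrib, hp, Finset.sum_ite_eq']
        simp [p]
      rw [hT, e1, ← hy] at key
      have e2 : ∀ φ : Fin M → Option (Fin k), P φ * (if v ∈ S φ then (1 : ℝ) else 0)
          = P φ - (∏ a, p (φ a)) * ∏ a ∈ T, (if φ a = some j then (0 : ℝ) else 1) := by
        intro φ
        have hm := hmem2 φ v j h
        by_cases hex : ∃ a : Fin M, (a : ℕ) ∈ ℓ v ∧ φ a = some j
        · rw [if_pos (hm.2 hex)]
          obtain ⟨a, ha, ha'⟩ := hex
          have hz : ∏ a ∈ T, (if φ a = some j then (0 : ℝ) else 1) = 0 :=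
            Finset.prod_eq_zero (i := a) (by simpa [T] using ha) (by simp [ha'])
          rw [hz]
          ring
        · have hz : ∏ a ∈ T, (if φ a = some j then (0 : ℝ) else 1) = 1 := by
            apply Finset.prod_eq_one
            intro a ha
            rw [if_neg]
            intro hh
            exact hex ⟨a, by simpa [T] using ha, hh⟩
          rw [if_neg (fun hh => hex (hm.1 hh)), hz]
          simp [P]
      simp_rw [e2]
      rw [Finset.sum_sub_distrib, hP1, key]
  have hE : ∑ φ, P φ * ((S φ).card : ℝ) = (1 - y) * Fintype.card V := by
    have : ∀ φ, P φ * ((S φ).card : ℝ) = ∑ v, P φ * (if v ∈ S φ then (1 : ℝ) else 0) := by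
      intro φ
      rw [← Finset.mul_sum]
      congr 1
      simp
    simp_rw [this]
    rw [Finset.sum_comm]
    simp_rw [hv]
    rw [Finset.sum_const, Finset.card_univ, nsmul_eq_mul, mul_comm]
  have hall : ∀ φ, ((S φ).card : ℝ) = (1 - y) * Fintype.card V := by
    have h0 : ∑ φ, P φ * ((1 - y) * Fintype.card V - ((S φ).card : ℝ)) = 0 := by
      simp_rw [mul_sub]
      rw [Finset.sum_sub_distrib, hE, ← Finset.sum_mul, hP1]
      ring
    rw [Finset.sum_eq_zero_iff_of_nonneg
      (fun φ _ => mul_nonneg (hPpos φ).le (sub_nonneg.2 (hS φ)))] at h0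
    intro φ
    have := h0 φ (Finset.mem_univ _)
    rcases mul_eq_zero.1 this with h | h
    · exact absurd h (hPpos φ).ne'
    · linarith
  -- constant allocations partition the vertex set
  have hpart : ∀ v, ∑ x : Option (Fin k), (if v ∈ S (fun _ => x) then (1 : ℝ) else 0) = 1 := by
    intro v
    rw [Fintype.sum_option]
    rcases hcase v with ⟨hl, h⟩ | ⟨j, h⟩
    · simp [hmem1 _ v h hl]
    · obtain ⟨a, ha⟩ : (ℓ v).Nonempty := by
        rw [← Finset.card_pos, hℓ]; omega
      have : ∀ x : Option (Fin k), v ∈ S (fun _ => x) ↔ x = some j := by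
        intro x
        rw [hmem2 _ v j h]
        exact ⟨fun ⟨_, _, h⟩ => h, fun h => ⟨⟨a, hM v a ha⟩, ha, h⟩⟩
      simp [this]
  have htot : (Fintype.card V : ℝ) = (k + 1) * ((1 - y) * Fintype.card V) := by
    have h1 : ∑ x : Option (Fin k), ((S (fun _ => x)).card : ℝ) = Fintype.card V := by
      have : ∀ x, ((S (fun _ => x)).card : ℝ)
          = ∑ v, (if v ∈ S (fun _ => x) then (1 : ℝ) else 0) := by
        intro x; simp
      simp_rw [this]
      rw [Finset.sum_comm]
      simp_rw [hpart]
      simp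
    simp_rw [hall] at h1
    simp at h1
    linarith
  have hnR : (0 : ℝ) < Fintype.card V := by exact_mod_cast hn
  have h1 : (1 : ℝ) = (k + 1) * (1 - y) := by
    apply mul_right_cancel₀ hnR.ne'
    linarith
  have h2 : 1 - y / k = y := by
    field_simp
    linarith
  rw [h2] at hy
  have h3 : y ^ t < y := pow_lt_self_of_lt_one₀ hy0 hy1 ht
  linarith
end

section
/- Let G be a finite simple graph on n vertices with list-chromatic number χ_ℓ(G) = 3. Then λ_2(G) > ((−1 + √5)/2) · n. -/
theorem round_aux (F : (ℕ → ℝ) → ℝ)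
    (hF : ∀ w i, F w = w i * F (Function.update w i 1) + (1 - w i) * F (Function.update w i 0))
    (S : Finset ℕ) (w : ℕ → ℝ) (hw : ∀ i, 0 ≤ w i ∧ w i ≤ 1) :
    ∃ w' : ℕ → ℝ, (∀ i, 0 ≤ w' i ∧ w' i ≤ 1) ∧ (∀ i ∈ S, w' i = 0 ∨ w' i = 1) ∧ F w ≤ F w' := by
  induction S using Finset.induction_on with
  | empty => exact ⟨w, hw, by simp, le_rfl⟩
  | insert i S hi ih =>
    obtain ⟨u, hu, hS, hle⟩ := ih
    have key : ∀ r : ℝ, (r = 0 ∨ r = 1) → F u ≤ F (Function.update u i r) →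
        ∃ w' : ℕ → ℝ, (∀ i, 0 ≤ w' i ∧ w' i ≤ 1) ∧
          (∀ j ∈ insert i S, w' j = 0 ∨ w' j = 1) ∧ F w ≤ F w' := by
      intro r hr h
      refine ⟨Function.update u i r, ?_, ?_, hle.trans h⟩
      · intro j
        by_cases hj : j = i
        · subst hj
          rcases hr with rfl | rfl <;> simp
        · simpa [Function.update_of_ne hj] using hu j
      · intro j hjS
        by_cases hj : j = i
        · subst hj
          simpa using hr
        · rw [Function.update_of_ne hj]
          exact hS j (by simpa [hj] using hjS)
    rcases le_total (F (Function.update u i 1)) (F (Function.update u i 0)) with h | h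
    · refine key 0 (Or.inl rfl) ?_
      rw [hF u i]
      nlinarith [hu i]
    · refine key 1 (Or.inr rfl) ?_
      rw [hF u i]
      nlinarith [hu i]

theorem color_aux {V : Type*} [Fintype V] (G : SimpleGraph V) (h3 : Choosable G 3)
    (ℓ : V → Finset ℕ) (hℓ : ∀ v, (ℓ v).card = 2) (q : ℝ) (hq0 : 0 ≤ q) (hq1 : q ≤ 1)
    (hq : 1 - q * q = q) :
    ∃ S : Finset V, (∃ c : V → ℕ, (∀ v ∈ S, c v ∈ ℓ v) ∧
      ∀ u ∈ S, ∀ w ∈ S, G.Adj u w → c u ≠ c w) ∧ q * (Fintype.card V : ℝ) ≤ S.card := by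
  classical
  have hN : ∃ N : ℕ, ∀ v, ∀ x ∈ ℓ v, x < N := by
    refine ⟨(Finset.univ.sup fun v => (ℓ v).sup id) + 1, fun v x hx => Nat.lt_succ_of_le ?_⟩
    exact (Finset.le_sup (f := id) hx).trans
      (Finset.le_sup (f := fun v => (ℓ v).sup id) (Finset.mem_univ v))
  obtain ⟨N, hN⟩ := hN
  obtain ⟨c, hc, hp⟩ := h3 (fun v => insert N (ℓ v)) (fun v => by
    rw [Finset.card_insert_of_notMem (fun hx => lt_irrefl _ (hN v N hx)), hℓ v])
  have hab : ∀ v, ∃ a b, a ≠ b ∧ ℓ v = {a, b} := fun v => Finset.card_eq_two.1 (hℓ v)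
  choose a b hne hl using hab
  have haN : ∀ v, a v < N := fun v => hN v _ (by simp [hl v])
  have hbN : ∀ v, b v < N := fun v => hN v _ (by simp [hl v])
  have hcl : ∀ v, c v ≠ N → c v ∈ ℓ v := fun v hv => by
    have := hc v
    simpa [hv] using this
  obtain ⟨w, -, hw, hle⟩ := round_aux
    (fun w => ∑ v, if c v = N then 1 - w (a v) * w (b v) else w (c v)) (by
      intro w i
      simp only [Finset.mul_sum, ← Finset.sum_add_distrib]
      refine Finset.sum_congr rfl fun v _ => ?_
      have := hne v
      by_cases h1 : c v = N
      · simp only [h1, if_true]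
        by_cases h2 : a v = i
        · have h3 : b v ≠ i := fun h => this (h2.trans h.symm)
          rw [Function.update_of_ne h3, Function.update_of_ne h3, h2]
          simp only [Function.update_self]
          ring
        · rw [Function.update_of_ne h2, Function.update_of_ne h2]
          by_cases h3 : b v = i
          · rw [h3]
            simp only [Function.update_self]
            ring
          · rw [Function.update_of_ne h3, Function.update_of_ne h3]
            ring
      · simp only [h1, if_false]
        by_cases h2 : c v = i
        · rw [h2]
          simp
        · rw [Function.update_of_ne h2, Function.update_of_ne h2]
          ring) (Finset.range N) (fun _ => q) (fun _ => ⟨hq0, hq1⟩)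
  simp only [Finset.mem_range] at hw
  refine ⟨Finset.univ.filter fun v => if c v = N then w (a v) = 0 ∨ w (b v) = 0 else w (c v) = 1,
    ⟨fun v => if c v = N then (if w (a v) = 0 then a v else b v) else c v, ?_, ?_⟩, ?_⟩
  · intro v _
    by_cases h1 : c v = N
    · simp only [h1, if_true, hl v]
      split_ifs <;> simp
    · simpa only [h1, if_false] using hcl v h1
  · have hz : ∀ v, (w (a v) = 0 ∨ w (b v) = 0) →
        w (if w (a v) = 0 then a v else b v) = 0 := by
      intro v hv
      split_ifs with h
      · exact h
      · exact hv.resolve_left h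
    intro u hu v hv hadj heq
    simp only [Finset.mem_filter, Finset.mem_univ, true_and] at hu hv
    have hcuv := hp u v hadj
    by_cases h1 : c u = N <;> by_cases h2 : c v = N <;>
      simp only [h1, h2, if_true, if_false] at hu hv heq
    · exact hcuv (h1.trans h2.symm)
    · have := hz u hu
      rw [heq, hv] at this
      exact one_ne_zero this
    · have := hz v hv
      rw [← heq, hu] at this
      exact one_ne_zero this
    · exact hcuv heq
  · have h0 : q * (Fintype.card V : ℝ) =
        ∑ v : V, if c v = N then 1 - q * q else q := by
      simp [hq, mul_comm]
    rw [h0]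
    refine hle.trans ?_
    rw [Finset.card_filter]
    push_cast
    refine Finset.sum_le_sum fun v _ => ?_
    by_cases h1 : c v = N
    · simp only [h1, if_true]
      rcases hw _ (haN v) with h | h <;> rcases hw _ (hbN v) with h' | h' <;> simp [h, h']
    · simp only [h1, if_false]
      rcases hw _ (hN v _ (hcl v h1)) with h | h <;> simp [h]

theorem stmt2 {V : Type*} [Fintype V] (G : SimpleGraph V)
    (h : listChromNum G = 3) :
    ((-1 + Real.sqrt 5) / 2) * (Fintype.card V : ℝ) < (lambdaList G 2 : ℝ) := by
  have hne : { s | Choosable G s }.Nonempty := by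
    by_contra hn
    rw [Set.not_nonempty_iff_eq_empty] at hn
    simp [listChromNum, hn] at h
  have h3 : Choosable G 3 := by
    have := Nat.sInf_mem hne
    rw [show sInf { s | Choosable G s } = 3 from h] at this
    exact this
  have hpos : 0 < Fintype.card V := by
    rw [Fintype.card_pos_iff]
    by_contra hV
    rw [not_nonempty_iff] at hV
    have h0 : Choosable G 0 := fun ℓ _ => ⟨fun _ => 0, fun v => hV.elim v, fun v => hV.elim v⟩
    have : listChromNum G ≤ 0 := Nat.sInf_le h0
    omega
  have hne2 : { m | ∃ ℓ : V → Finset ℕ, (∀ v, (ℓ v).card = 2) ∧ maxColorable G ℓ = m }.Nonempty :=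
    ⟨_, fun _ => {0, 1}, fun _ => by simp, rfl⟩
  obtain ⟨ℓ, hℓ, hm⟩ := Nat.sInf_mem hne2
  change maxColorable G ℓ = lambdaList G 2 at hm
  have h5 : Real.sqrt 5 * Real.sqrt 5 = 5 := Real.mul_self_sqrt (by norm_num)
  have h50 := Real.sqrt_nonneg 5
  obtain ⟨S, hS, hle⟩ := color_aux G h3 ℓ hℓ ((-1 + Real.sqrt 5) / 2)
    (by nlinarith) (by nlinarith) (by nlinarith)
  have hSm : S.card ≤ lambdaList G 2 := by
    rw [← hm]
    refine le_csSup ⟨Fintype.card V, ?_⟩ ⟨S, hS, rfl⟩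
    rintro m ⟨T, -, rfl⟩
    exact Finset.card_le_univ T
  have hlt : ((-1 + Real.sqrt 5) / 2) * (Fintype.card V : ℝ) < S.card := by
    refine lt_of_le_of_ne hle fun he => ?_
    have hirr : Irrational (Real.sqrt 5) := by
      simpa using (Nat.Prime.irrational_sqrt (p := 5) (by norm_num))
    apply hirr
    refine ⟨2 * (S.card : ℚ) / (Fintype.card V : ℚ) + 1, ?_⟩
    have hc : (Fintype.card V : ℝ) ≠ 0 := by exact_mod_cast hpos.ne'
    push_cast
    rw [← he]
    field_simp
    ring
  exact hlt.trans_le (by exact_mod_cast hSm)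
end

section
/- For all integers s > t > 0, the number q_{s,t} satisfies (6/7) · (t/s) < q_{s,t} ≤ t/s. -/
lemma sub_log_sinh {z : ℝ} (hz : 1 ≤ z) : Real.log z ≤ (z - z⁻¹) / 2 := by
  have h := Real.self_le_sinh_iff.2 (Real.log_nonneg hz)
  rwa [Real.sinh_log (by linarith)] at h

lemma sub_log_key {y : ℝ} (h1 : 1 < y) (h7 : y < 7) :
    Real.log y < 7 * (y - 1) / (y * (7 - y)) := by
  have hy : 0 < y := by linarith
  have h7' : 0 < 7 - y := by linarith
  have hl2 := Real.log_two_lt_d9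
  rcases le_total y (79 / 50) with h | h
  · refine lt_of_le_of_lt (sub_log_sinh h1.le) ?_
    rw [lt_div_iff₀ (by positivity)]
    have e : (y - y⁻¹) / 2 * (y * (7 - y)) = (y - 1) * ((y + 1) * (7 - y) / 2) := by
      field_simp
      ring
    rw [e]
    nlinarith [mul_pos (sub_pos.2 h1) (show 0 < y ^ 2 - 6 * y + 7 by nlinarith)]
  · rcases le_total y 2 with h2 | h2
    · have hb := Real.le_log_one_add_of_nonneg (x := 2 / y - 1)
        (by rw [sub_nonneg, le_div_iff₀ hy]; linarith)
      have e : 1 + (2 / y - 1) = 2 / y := by ring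
      rw [e, Real.log_div (by norm_num) hy.ne'] at hb
      have e2 : 2 * (2 / y - 1) / (2 / y - 1 + 2) = 2 * (2 - y) / (y + 2) := by
        have : (2 / y - 1 + 2) = (y + 2) / y := by field_simp; ring
        rw [this]
        field_simp
      rw [e2] at hb
      have : 0.6932 - 2 * (2 - y) / (y + 2) < 7 * (y - 1) / (y * (7 - y)) := by
        rw [lt_div_iff₀ (by positivity), ← sub_pos]
        have e3 : 7 * (y - 1) - (0.6932 - 2 * (2 - y) / (y + 2)) * (y * (7 - y))
          = (7 * (y - 1) * (y + 2) - (0.6932 * (y + 2) - 2 * (2 - y)) * (y * (7 - y))) / (y + 2) := by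
          field_simp
        rw [e3]
        apply div_pos _ (by linarith)
        nlinarith [mul_nonneg (sub_nonneg.2 h) (sub_nonneg.2 h2), mul_nonneg (mul_nonneg (sub_nonneg.2 h) (sub_nonneg.2 h2)) hy.le, sq_nonneg (y - 2), sq_nonneg (y - 1.8)]
      linarith
    · have hb := sub_log_sinh (z := y / 2) (by linarith)
      rw [Real.log_div hy.ne' (by norm_num)] at hb
      have : 0.6932 + (y / 2 - (y / 2)⁻¹) / 2 < 7 * (y - 1) / (y * (7 - y)) := by
        rw [lt_div_iff₀ (by positivity)]
        have e3 : (0.6932 + (y / 2 - (y / 2)⁻¹) / 2) * (y * (7 - y))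
          = (0.6932 * y + (y ^ 2 - 4) / 4) * (7 - y) := by
          field_simp
          ring
        rw [e3]
        nlinarith [mul_nonneg (sub_nonneg.2 h2) (sq_nonneg (y - 2.1)), sq_nonneg (y - 2.1), mul_nonneg (sub_nonneg.2 h2) h7'.le]
      linarith

theorem stmt5 (s t : ℕ) (hts : t < s) (ht : 0 < t)
    (q : ℝ) (hq : 0 < q) (hroot : fst s t q = 0) :
    (6 / 7 : ℝ) * ((t : ℝ) / (s : ℝ)) < q ∧ q ≤ (t : ℝ) / (s : ℝ) := by
  unfold fst at hroot
  have hT : (0 : ℝ) < t := by exact_mod_cast ht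
  have hd1 : (1 : ℝ) ≤ (s : ℝ) - t := by
    have : ((t + 1 : ℕ) : ℝ) ≤ s := by exact_mod_cast hts
    push_cast at this
    linarith
  obtain ⟨d, hd⟩ : ∃ d : ℝ, d = (s : ℝ) - t := ⟨_, rfl⟩
  have hs : (s : ℝ) = d + t := by linarith
  rw [← hd] at hroot hd1
  rw [hs]
  have hd0 : 0 < d := by linarith
  obtain ⟨p, hp⟩ : ∃ p : ℝ, p = 1 - q := ⟨_, rfl⟩
  rw [← hp] at hroot
  have hroot' : p = (1 - p / d) ^ t := by linarith
  have hpd : p / d ≤ 1 := by rw [div_le_one hd0]; linarith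
  constructor
  · by_contra hc
    push Not at hc
    obtain ⟨P, hP⟩ : ∃ P : ℝ, P = (7 * d + t) / (7 * (d + t)) := ⟨_, rfl⟩
    have hP0 : 0 < P := by rw [hP]; positivity
    have hPp : P ≤ p := by
      have : P = 1 - 6 / 7 * (t / (d + t)) := by rw [hP]; field_simp; ring
      linarith
    have hk := sub_log_key (y := P⁻¹)
      (by rw [hP, inv_div, lt_div_iff₀ (by positivity)]; linarith)
      (by rw [hP, inv_div, div_lt_iff₀ (by positivity)]; linarith)
    have e : 7 * (P⁻¹ - 1) / (P⁻¹ * (7 - P⁻¹)) = P * t / d := by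
      have e1 : P⁻¹ - 1 = 6 * t / (7 * d + t) := by rw [hP]; field_simp; ring
      have e2 : 7 - P⁻¹ = 42 * d / (7 * d + t) := by rw [hP]; field_simp; ring
      rw [e1, e2]
      field_simp
      ring
    rw [e, Real.log_inv] at hk
    have h1 : Real.exp (-(P * t / d)) < P := by
      rw [← Real.lt_log_iff_exp_lt hP0]; linarith
    have h2 : (1 - p / d) ^ t ≤ Real.exp (-(p / d)) ^ t :=
      pow_le_pow_left₀ (by linarith) (Real.one_sub_le_exp_neg _) t
    rw [← Real.exp_nat_mul, ← hroot'] at h2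
    have h3 : Real.exp (t * -(p / d)) ≤ Real.exp (-(P * t / d)) := by
      apply Real.exp_le_exp.2
      have : P * t / d ≤ p * t / d := by gcongr
      have e4 : (t : ℝ) * -(p / d) = -(p * t / d) := by ring
      linarith
    linarith
  · have hB := one_add_mul_le_pow (a := -(p / d)) (by linarith) t
    rw [← sub_eq_add_neg, ← hroot'] at hB
    have e : (t : ℝ) * -(p / d) * d = - (t * p) := by field_simp
    have : d - t * p ≤ p * d := by nlinarith
    rw [le_div_iff₀ (by positivity)]
    have : q = 1 - p := by linarith
    subst this
    nlinarith
end

section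
/- For all integers s > t > 1, the number q_{s,t} is irrational. -/
theorem rat_root_is_int (n : ℤ) (t : ℕ) (ht : 1 < t) (y : ℚ)
    (h : y ^ t = n * (1 - y)) : ∃ k : ℤ, (k : ℚ) = y := by
  have hint : IsIntegral ℤ y := by
    refine ⟨Polynomial.X ^ t + (Polynomial.C n * Polynomial.X + Polynomial.C (-n)), ?_, ?_⟩
    · apply Polynomial.monic_X_pow_add
      refine lt_of_le_of_lt Polynomial.degree_linear_le ?_
      exact_mod_cast ht
    · simp only [Polynomial.eval₂_add, Polynomial.eval₂_mul, Polynomial.eval₂_X_pow, Polynomial.eval₂_X,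
        Polynomial.eval₂_C, h]
      simp only [algebraMap_int_eq, eq_intCast]
      push_cast
      ring
  obtain ⟨k, hk⟩ := IsIntegrallyClosed.isIntegral_iff.mp hint
  exact ⟨k, by simpa using hk⟩

theorem stmt7 (s t : ℕ) (hts : t < s) (ht : 1 < t)
    (q : ℝ) (hq : 0 < q) (hroot : fst s t q = 0) :
    Irrational q := by
  rintro ⟨r, rfl⟩
  obtain ⟨n, rfl⟩ := Nat.exists_eq_add_of_lt hts
  unfold fst at hroot
  push_cast at hroot
  have e : ((t : ℝ) + n + 1 - t) = n + 1 := by ring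
  rw [e] at hroot
  have hn : (0 : ℝ) < (n : ℝ) + 1 := by positivity
  have hn' : (n : ℚ) + 1 ≠ 0 := by positivity
  have hr : 1 - r - (1 - (1 - r) / ((n : ℚ) + 1)) ^ t = 0 := by exact_mod_cast hroot
  have hq' : 0 < r := by exact_mod_cast hq
  obtain ⟨y, hy⟩ : ∃ y : ℚ, y = 1 - (1 - r) / ((n : ℚ) + 1) := ⟨_, rfl⟩
  rw [← hy] at hr
  have hy2 : 1 - r = ((n : ℚ) + 1) * (1 - y) := by
    rw [hy]; field_simp; ring
  have hyt : y ^ t = (((n : ℤ) + 1 : ℤ) : ℚ) * (1 - y) := by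
    push_cast; linarith
  obtain ⟨k, rfl⟩ := rat_root_is_int _ t ht y hyt
  have hn0 : (0 : ℚ) ≤ n := by positivity
  have hk : 0 < k := by
    by_contra hneg
    have : (k : ℚ) ≤ 0 := by exact_mod_cast not_lt.mp hneg
    nlinarith
  have hk1 : (1 : ℚ) ≤ k := by exact_mod_cast hk
  have hpos : (0 : ℚ) < (k : ℚ) ^ t := by positivity
  push_cast at hyt
  nlinarith
end

section
/- Let G be a finite simple graph on n vertices with list-chromatic number χ_ℓ(G) ≥ 1. Then λ_1(G) ≥ n/χ_ℓ(G); that is, for every assignment of a single color to each vertex, some set of at least n/χ_ℓ(G) vertices can be properly colored, each with its assigned color. -/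
theorem stmt9 {V : Type*} [Fintype V] (G : SimpleGraph V)
    (h : 1 ≤ listChromNum G) :
    (Fintype.card V : ℝ) / (listChromNum G : ℝ) ≤ (lambdaList G 1 : ℝ) := by
  classical
  set s := listChromNum G with hs
  have hne : {s | Choosable G s}.Nonempty := by
    by_contra hc
    rw [Set.not_nonempty_iff_eq_empty] at hc
    have : s = 0 := by rw [hs, listChromNum, hc, Nat.sInf_empty]
    omega
  have hch : Choosable G s := Nat.sInf_mem hne
  obtain ⟨c, hc, hadj⟩ := hch (fun _ => Finset.range s) (fun _ => Finset.card_range s)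
  have hne2 : {m | ∃ ℓ : V → Finset ℕ, (∀ v, (ℓ v).card = 1) ∧ maxColorable G ℓ = m}.Nonempty :=
    ⟨_, fun _ => {0}, fun _ => Finset.card_singleton 0, rfl⟩
  obtain ⟨ℓ, hℓ, hm⟩ := Nat.sInf_mem hne2
  change maxColorable G ℓ = lambdaList G 1 at hm
  -- every color class is partially colorable from the singleton lists
  have hclass : ∀ i ∈ Finset.range s,
      (Finset.univ.filter (fun v => c v = i)).card ≤ lambdaList G 1 := by
    intro i _
    rw [← hm]
    refine le_csSup ⟨Fintype.card V, ?_⟩ ⟨Finset.univ.filter (fun v => c v = i), ?_, rfl⟩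
    · rintro m ⟨S, _, rfl⟩
      exact Finset.card_le_univ S
    · have hex : ∀ v, ∃ a, a ∈ ℓ v := fun v =>
        Finset.card_pos.mp (by rw [hℓ v]; exact Nat.one_pos)
      choose d hd using hex
      refine ⟨d, fun v _ => hd v, ?_⟩
      intro u hu w hw huw
      simp only [Finset.mem_filter, Finset.mem_univ, true_and] at hu hw
      exact absurd (hu.trans hw.symm) (hadj u w huw)
  have hcard : Fintype.card V ≤ s * lambdaList G 1 := by
    have h1 := Finset.card_eq_sum_card_fiberwise (s := (Finset.univ : Finset V))
      (t := Finset.range s) (f := c) (fun v _ => hc v)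
    have h2 := Finset.sum_le_card_nsmul _ _ _ hclass
    rw [← h1, Finset.card_range, smul_eq_mul] at h2
    exact h2
  have hpos : (0 : ℝ) < (s : ℝ) := by exact_mod_cast h
  rw [div_le_iff₀ hpos, mul_comm]
  exact_mod_cast hcard
end

section
/- Let G be a finite simple graph on vertex set V that is s-choosable, let t be an integer with 0 < t < s, set u = s − t, and let ℓ be an assignment of a list of t colors to each vertex. Then there exist pairwise disjoint independent sets I_1, ..., I_u in G and a function φ defined on H = V ∖ (I_1 ∪ ... ∪ I_u) such that φ is a proper coloring of the subgraph of G induced on H and φ(v) ∈ ℓ(v) for every v ∈ H. -/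
theorem stmt11 {V : Type*} [Fintype V] (G : SimpleGraph V) (s t : ℕ)
    (hts : t < s) (ht : 0 < t) (hch : Choosable G s)
    (ℓ : V → Finset ℕ) (hℓ : ∀ v, (ℓ v).card = t) :
    ∃ I : Fin (s - t) → Set V,
      (∀ i j, i ≠ j → Disjoint (I i) (I j)) ∧
      (∀ i, ∀ x ∈ I i, ∀ y ∈ I i, ¬ G.Adj x y) ∧
      ∃ φ : V → ℕ,
        (∀ v, (∀ i, v ∉ I i) → φ v ∈ ℓ v) ∧
        (∀ u w, (∀ i, u ∉ I i) → (∀ i, w ∉ I i) → G.Adj u w → φ u ≠ φ w) := by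
  classical
  obtain ⟨M, hM⟩ : ∃ M : ℕ, ∀ v, ∀ a ∈ ℓ v, a < M := by
    refine ⟨(Finset.univ.biUnion ℓ).sup id + 1, fun v a ha => ?_⟩
    have h : a ∈ Finset.univ.biUnion ℓ :=
      Finset.mem_biUnion.mpr ⟨v, Finset.mem_univ v, ha⟩
    have h2 : id a ≤ (Finset.univ.biUnion ℓ).sup id := Finset.le_sup h
    exact Nat.lt_succ_of_le h2
  obtain ⟨c, hc, hadj⟩ := hch (fun v => ℓ v ∪ Finset.Ico M (M + (s - t))) (by
    intro v
    rw [Finset.card_union_of_disjoint, hℓ v, Nat.card_Ico]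
    · omega
    · rw [Finset.disjoint_left]
      intro a ha hb
      have h1 := hM v a ha
      have h2 := (Finset.mem_Ico.mp hb).1
      omega)
  refine ⟨fun i => {v | c v = M + i}, ?_, ?_, c, ?_, ?_⟩
  · intro i j hij
    rw [Set.disjoint_left]
    intro v hi hj
    simp only [Set.mem_setOf_eq] at hi hj
    apply hij
    ext
    omega
  · intro i x hx y hy h
    simp only [Set.mem_setOf_eq] at hx hy
    exact hadj x y h (hx.trans hy.symm)
  · intro v hv
    rcases Finset.mem_union.mp (hc v) with h | h
    · exact h
    · have h' := Finset.mem_Ico.mp h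
      refine absurd ?_ (hv ⟨c v - M, by omega⟩)
      simp only [Set.mem_setOf_eq]
      omega
  · intro u w _ _ h
    exact hadj u w h
end

section
/- Let c = 6/7 and define g(v) = ln(1 − c·v) + v·(1 − c·v)/(1 − v) for real v. Then g(v) > 0 for all v with 0 < v < 1. -/
lemma log_pade_aux (t : ℝ) (h0 : 0 < t) (h1 : t < 1) :
    0 ≤ t * (30 - 39 * t + 10 * t ^ 2) / (3 * (1 - t) * (10 - 8 * t + t ^ 2))
      + Real.log (1 - t) := by
  have hd : ∀ x : ℝ, x < 1 → HasDerivAt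
      (fun t : ℝ => t * (30 - 39 * t + 10 * t ^ 2) / (3 * (1 - t) * (10 - 8 * t + t ^ 2))
      + Real.log (1 - t)) (x ^ 5 / ((1 - x) ^ 2 * (10 - 8 * x + x ^ 2) ^ 2)) x := by
    intro x hx
    have ha : (1 - x) ≠ 0 := by linarith
    have hb : (10 - 8 * x + x ^ 2) ≠ 0 := by nlinarith
    have i := hasDerivAt_id x
    have hN : HasDerivAt (fun t : ℝ => t * (30 - 39 * t + 10 * t ^ 2))
        (30 - 78 * x + 30 * x ^ 2) x := by
      refine (i.mul (((i.const_mul 39).const_sub 30).add ((i.pow 2).const_mul 10))).congr_deriv ?_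
      simp [id]
      ring
    have hD : HasDerivAt (fun t : ℝ => 3 * (1 - t) * (10 - 8 * t + t ^ 2))
        (-54 + 54 * x - 9 * x ^ 2) x := by
      refine (((i.const_sub 1).const_mul 3).mul
        (((i.const_mul 8).const_sub 10).add (i.pow 2))).congr_deriv ?_
      simp [id]
      ring
    have hL := (i.const_sub 1).log ha
    have h := (hN.div hD (by positivity)).add hL
    refine h.congr_deriv ?_
    simp only [id]
    rw [div_add_div _ _ (by positivity) ha, div_eq_div_iff (by positivity) (by positivity)]
    ring
  have hm : MonotoneOn (fun t : ℝ => t * (30 - 39 * t + 10 * t ^ 2)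
      / (3 * (1 - t) * (10 - 8 * t + t ^ 2)) + Real.log (1 - t)) (Set.Icc 0 t) := by
    apply monotoneOn_of_deriv_nonneg (convex_Icc 0 t)
    · intro x hx
      exact (hd x (lt_of_le_of_lt hx.2 h1)).continuousAt.continuousWithinAt
    · intro x hx
      rw [interior_Icc] at hx
      exact (hd x (hx.2.trans h1)).differentiableAt.differentiableWithinAt
    · intro x hx
      rw [interior_Icc] at hx
      rw [(hd x (hx.2.trans h1)).deriv]
      have := hx.1
      positivity
  have := hm (Set.left_mem_Icc.2 h0.le) (Set.right_mem_Icc.2 h0.le) h0.le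
  simpa using this

theorem stmt14 :
    ∀ v : ℝ, 0 < v → v < 1 →
      0 < Real.log (1 - (6 / 7) * v) + v * (1 - (6 / 7) * v) / (1 - v) := by
  intro v h0 h1
  have h := log_pade_aux (6 / 7 * v) (by linarith) (by linarith)
  have ha : 0 < 1 - 6 / 7 * v := by linarith
  have hb : 0 < 10 - 8 * (6 / 7 * v) + (6 / 7 * v) ^ 2 := by nlinarith
  have hc : 0 < 1 - v := by linarith
  have hP : 0 < 1715 - 7056 * v + 9828 * v ^ 2 - 5040 * v ^ 3 + 648 * v ^ 4 := by
    nlinarith [mul_nonneg hc.le (sq_nonneg (v - 637 / 1000)),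
      sq_nonneg ((1 - v) * (v - 637 / 1000)), sq_nonneg (v - 637 / 1000)]
  have key : 6 / 7 * v * (30 - 39 * (6 / 7 * v) + 10 * (6 / 7 * v) ^ 2)
      / (3 * (1 - 6 / 7 * v) * (10 - 8 * (6 / 7 * v) + (6 / 7 * v) ^ 2))
      < v * (1 - 6 / 7 * v) / (1 - v) := by
    rw [div_lt_div_iff₀ (by positivity) hc]
    nlinarith [mul_pos h0 hP]
  linarith
end

section
/- Let s > t > 0 be integers, let c = 6/7 and v = t/s. Then f_{s,t}(c·v) > 1 − c·v − e^{−v·(1 − c·v)/(1 − v)}, where e denotes Euler's number. -/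
theorem stmt15 (s t : ℕ) (hts : t < s) (ht : 0 < t) :
    1 - (6 / 7) * ((t : ℝ) / (s : ℝ))
        - Real.exp (-(((t : ℝ) / (s : ℝ)) * (1 - (6 / 7) * ((t : ℝ) / (s : ℝ)))
            / (1 - (t : ℝ) / (s : ℝ))))
      < fst s t ((6 / 7) * ((t : ℝ) / (s : ℝ))) := by
  have hs : (0 : ℝ) < s := by exact_mod_cast (ht.trans hts)
  have ht' : (0 : ℝ) < t := by exact_mod_cast ht
  have h1 : (1 : ℝ) ≤ (s : ℝ) - t := by
    have : (t : ℝ) + 1 ≤ s := by exact_mod_cast hts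
    linarith
  have hv0 : 0 < (t : ℝ) / s := div_pos ht' hs
  have hv1 : (t : ℝ) / s < 1 := by
    rw [div_lt_one hs]; linarith
  have hd : (0 : ℝ) < (s : ℝ) - t := by linarith
  have hexp : -(((t : ℝ) / (s : ℝ)) * (1 - (6 / 7) * ((t : ℝ) / (s : ℝ)))
      / (1 - (t : ℝ) / (s : ℝ)))
      = t * (-((1 - (6 / 7) * ((t : ℝ) / (s : ℝ))) / ((s : ℝ) - t))) := by
    have h2 : 1 - (t : ℝ) / s = (s - t) / s := by field_simp
    rw [h2]
    field_simp
  unfold fst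
  rw [hexp, Real.exp_nat_mul]
  set x := (6 / 7) * ((t : ℝ) / (s : ℝ)) with hx
  have hy0 : 0 < (1 - x) / ((s : ℝ) - t) := div_pos (by linarith) hd
  have hy1 : (1 - x) / ((s : ℝ) - t) ≤ 1 := by
    rw [div_le_one hd]; linarith
  have hlt := Real.add_one_lt_exp (x := -((1 - x) / ((s : ℝ) - t))) (by linarith)
  have := pow_lt_pow_left₀ (a := 1 - (1 - x) / ((s : ℝ) - t))
    (b := Real.exp (-((1 - x) / ((s : ℝ) - t)))) (by linarith) (by linarith) ht.ne'
  linarith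
end
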